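/- For every symmetric reflexive relation S on the set R of rays of T'_m, the following are equivalent: (i) A^S_{u,v}∈F for all u,v∈V; (ii) A'^S_{u,v}∈F for all u,v∈V; (iii) A^S_{u,v}∈F for all incomparable u,v∈V; (iv) K^S_{u,v}∈F for all u,v∈V; (v) K^S_{u,v,Λ}∈F for all finite subsets Λ⊆V and all u,v∈Λ; (vi) K^S_e∈F for all edges e∈E. -/

import Mathlib

open MeasureTheory

namespace RCTree

abbrev Edge (m : ℕ) := Fin (m + 1) × List (Fin m)
abbrev V (m : ℕ) := Option (Edge m)
abbrev Ray (m : ℕ) := Fin (m + 1) × (ℕ → Fin m)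
abbrev Config (m : ℕ) := Edge m → Bool

variable {m : ℕ}

/-- The vertex at the top (towards the root) of an edge. -/
def parentV (e : Edge m) : V m :=
  if e.2 = [] then none else some (e.1, e.2.dropLast)

/-- The vertex at the bottom (away from the root) of an edge. -/
def childV (e : Edge m) : V m := some e

/-- The (undirected) edge `e` has endvertices `u` and `v`. -/
def EndsAt (e : Edge m) (u v : V m) : Prop :=
  (parentV e = u ∧ childV e = v) ∨ (parentV e = v ∧ childV e = u)

/-- The `n`-th edge of a ray from the root. -/
def rayEdge (ρ : Ray m) (n : ℕ) : Edge m := (ρ.1, List.ofFn fun k : Fin n => ρ.2 k)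

/-- The `n`-th vertex of a ray from the root. -/
def rayVtx (ρ : Ray m) : ℕ → V m
  | 0 => none
  | n + 1 => some (rayEdge ρ n)

def rayEdges (ρ : Ray m) : Set (Edge m) := Set.range (rayEdge ρ)

/-- The ray `ρ` passes through the vertex `v`. -/
def RayThrough (ρ : Ray m) (v : V m) : Prop := ∃ n, rayVtx ρ n = v

/-- All edges of the ray `ρ` are open in `ω`. -/
def OpenRay (ω : Config m) (ρ : Ray m) : Prop := ∀ n, ω (rayEdge ρ n) = true

/-- An infinite self-avoiding (undirected) path with endpoint `x`. -/
structure IPath (m : ℕ) (x : V m) where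
  vtx : ℕ → V m
  start : vtx 0 = x
  inj : Function.Injective vtx
  adj : ∀ n, ∃ e : Edge m, EndsAt e (vtx n) (vtx (n + 1))

/-- The edges traversed by an infinite path. -/
def IPath.edges {x : V m} (π : IPath m x) : Set (Edge m) :=
  {e | ∃ n, EndsAt e (π.vtx n) (π.vtx (n + 1))}

/-- A path is forward (an `x`-ray) if it is directed away from the root. -/
def IPath.Forward {x : V m} (π : IPath m x) : Prop :=
  ∀ n, ∃ e : Edge m, parentV e = π.vtx n ∧ childV e = π.vtx (n + 1)

/-- All edges of the path `π` are open in `ω`. -/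
def OpenPath {x : V m} (ω : Config m) (π : IPath m x) : Prop :=
  ∀ e ∈ π.edges, ω e = true

/-- The path `π` and the `0`-ray `ρ` differ in only finitely many edges:
`ρ` is the `0`-ray associated with `π`. -/
def Assoc {x : V m} (π : IPath m x) (ρ : Ray m) : Prop :=
  ((IPath.edges π \ rayEdges ρ) ∪ (rayEdges ρ \ IPath.edges π)).Finite

/-- The set of edges with both endvertices in `Λ`. -/
def ELam (Λ : Set (V m)) : Set (Edge m) :=
  {e | parentV e ∈ Λ ∧ childV e ∈ Λ}

/-- The event `K^S_{u,v,Λ}`: there exist vertex-disjoint open infinite paths from `u` and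
from `v`, edge-disjoint from `E_Λ`, whose associated `0`-rays are `S`-related. -/
def KEvent (S : Ray m → Ray m → Prop) (Λ : Set (V m)) (u v : V m) : Set (Config m) :=
  {ω | ∃ (πu : IPath m u) (πv : IPath m v),
      (∀ a b, πu.vtx a ≠ πv.vtx b) ∧
      OpenPath ω πu ∧ OpenPath ω πv ∧
      (∀ e ∈ πu.edges, e ∉ ELam Λ) ∧ (∀ e ∈ πv.edges, e ∉ ELam Λ) ∧
      ∃ ρu ρv : Ray m, Assoc πu ρu ∧ Assoc πv ρv ∧ S ρu ρv}

/-- The event `A^S_{u,v}`: there exist open `u`- and `v`-rays whose associated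
`0`-rays are `S`-related. -/
def AEvent (S : Ray m → Ray m → Prop) (u v : V m) : Set (Config m) :=
  {ω | ∃ (πu : IPath m u) (πv : IPath m v),
      πu.Forward ∧ πv.Forward ∧ OpenPath ω πu ∧ OpenPath ω πv ∧
      ∃ ρu ρv : Ray m, Assoc πu ρu ∧ Assoc πv ρv ∧ S ρu ρv}

/-- The event `A'^S_{u,v}`: there exist open `0`-rays through `u` and through `v`
that are `S`-related. -/
def APrimeEvent (S : Ray m → Ray m → Prop) (u v : V m) : Set (Config m) :=
  {ω | ∃ ρu ρv : Ray m, RayThrough ρu u ∧ RayThrough ρv v ∧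
      OpenRay ω ρu ∧ OpenRay ω ρv ∧ S ρu ρv}

/-- `u` lies on the (unique) path of the tree from the root to `v` (ancestor-or-equal). -/
def Anc : V m → V m → Prop
  | none, _ => True
  | some _, none => False
  | some e, some f => e.1 = f.1 ∧ e.2 <+: f.2

/-- Two vertices are comparable if one lies on the path from the root to the other. -/
def Comparable (u v : V m) : Prop := Anc u v ∨ Anc v u

/-- `W` is a cutset: it is incomparable (no ray contains more than one member of `W`)
and every ray contains some member of `W`. -/
def IsCutset (W : Set (V m)) : Prop :=
  (∀ (ρ : Ray m) (u v : V m), u ∈ W → v ∈ W → RayThrough ρ u → RayThrough ρ v → u = v) ∧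
  ∀ ρ : Ray m, ∃ v ∈ W, RayThrough ρ v


/-- The distance of a vertex from the root. -/
def depth : V m → ℕ
  | none => 0
  | some e => e.2.length + 1

@[simp] lemma depth_some (e : Edge m) : depth (some e) = e.2.length + 1 := rfl

/-- The ancestor of a vertex at depth `k` (the vertex itself if its depth is at most `k`). -/
def up : ℕ → V m → V m
  | 0, _ => none
  | _ + 1, none => none
  | k + 1, some e => some (e.1, e.2.take k)

@[simp] lemma up_zero (v : V m) : up 0 v = none := by cases v <;> rfl

lemma depth_up (k : ℕ) (v : V m) : depth (up k v) = min k (depth v) := by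
  rcases k with _ | k <;> rcases v with _ | e <;> simp [up, depth]

lemma up_up (j k : ℕ) (v : V m) : up j (up k v) = up (min j k) v := by
  rcases j with _ | j <;> rcases k with _ | k <;> rcases v with _ | e <;>
    simp [up, List.take_take, Nat.succ_min_succ]

lemma up_of_depth_le {k : ℕ} {v : V m} (h : depth v ≤ k) : up k v = v := by
  rcases k with _ | k <;> rcases v with _ | e <;> simp_all [up, depth, List.take_of_length_le]

lemma eq_none_of_depth {v : V m} (h : depth v = 0) : v = none := by
  rcases v with _ | e
  · rfl
  · simp [depth] at h

lemma parentV_eq_up (e : Edge m) : parentV e = up e.2.length (some e) := by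
  obtain ⟨i, l⟩ := e
  rcases l with _ | ⟨a, l⟩
  · simp [parentV]
  · simp [parentV, up, List.dropLast_eq_take]

lemma depth_parentV (e : Edge m) : depth (parentV e) = e.2.length := by
  rw [parentV_eq_up, depth_up]; simp [depth]

lemma depth_childV (e : Edge m) : depth (childV e) = e.2.length + 1 := rfl

lemma anc_iff (u v : V m) : Anc u v ↔ up (depth u) v = u := by
  rcases u with _ | ⟨i, l⟩
  · simp [Anc, depth]
  · rcases v with _ | ⟨j, l'⟩
    · simp [Anc, depth, up]
    · simp only [Anc, depth, up, Option.some.injEq, Prod.mk.injEq, List.prefix_iff_eq_take]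
      constructor <;> rintro ⟨h, h'⟩ <;> exact ⟨h.symm, h'.symm⟩

@[simp] lemma depth_rayVtx (ρ : Ray m) (n : ℕ) : depth (rayVtx ρ n) = n := by
  rcases n with _ | n <;> simp [depth, rayVtx, rayEdge]

lemma take_ofFn (f : ℕ → Fin m) {k n : ℕ} (h : k ≤ n) :
    (List.ofFn fun i : Fin n => f i).take k = List.ofFn fun i : Fin k => f i := by
  apply List.ext_getElem
  · simp [h]
  · intro i _ _
    simp

lemma up_rayVtx (ρ : Ray m) {k n : ℕ} (h : k ≤ n) : up k (rayVtx ρ n) = rayVtx ρ k := by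
  rcases k with _ | k
  · simp [rayVtx]
  · rcases n with _ | n
    · omega
    · simp [rayVtx, rayEdge, up, take_ofFn ρ.2 (Nat.le_of_succ_le_succ h)]

lemma rayThrough_iff (ρ : Ray m) (v : V m) : RayThrough ρ v ↔ rayVtx ρ (depth v) = v := by
  constructor
  · rintro ⟨n, rfl⟩
    simp
  · exact fun h => ⟨_, h⟩

@[simp] lemma childV_rayEdge (ρ : Ray m) (k : ℕ) : childV (rayEdge ρ k) = rayVtx ρ (k + 1) := rfl

@[simp] lemma parentV_rayEdge (ρ : Ray m) (k : ℕ) : parentV (rayEdge ρ k) = rayVtx ρ k := by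
  have h : (rayEdge ρ k).2.length = k := by simp [rayEdge]
  rw [parentV_eq_up, h]
  exact up_rayVtx ρ k.le_succ

lemma rayEdge_eq_iff (ρ : Ray m) (k : ℕ) (e : Edge m) :
    rayEdge ρ k = e ↔ rayVtx ρ (k + 1) = some e := by
  simp [rayVtx]

lemma rayEdge_injective (ρ : Ray m) : Function.Injective (rayEdge ρ) := by
  intro a b h
  have := congrArg (fun e => e.2.length) h
  simpa [rayEdge] using this

lemma ray_ext {ρ σ : Ray m} (h : ∀ n, rayVtx ρ n = rayVtx σ n) : ρ = σ := by
  have h' : ∀ n, rayEdge ρ n = rayEdge σ n := fun n => by simpa [rayVtx] using h (n + 1)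
  have h0 : (rayEdge ρ 0).1 = (rayEdge σ 0).1 := congrArg Prod.fst (h' 0)
  refine Prod.ext h0 (funext fun k => ?_)
  have := congrArg Prod.snd (h' (k + 1))
  simp only [rayEdge, List.ofFn_inj] at this
  exact congrFun this (Fin.last k)

lemma endsAt_ray_iff (ρ : Ray m) (k : ℕ) (e : Edge m) :
    EndsAt e (rayVtx ρ k) (rayVtx ρ (k + 1)) ↔ e = rayEdge ρ k := by
  constructor
  · rintro (⟨-, h⟩ | ⟨h, h'⟩)
    · exact ((rayEdge_eq_iff ρ k e).2 h.symm).symm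
    · have h1 := congrArg depth h
      have h2 := congrArg depth h'
      simp only [depth_parentV, depth_childV, depth_rayVtx] at h1 h2
      omega
  · rintro rfl
    exact Or.inl ⟨parentV_rayEdge ρ k, rfl⟩

lemma endsAt_subsingleton (u v : V m) : {e : Edge m | EndsAt e u v}.Subsingleton := by
  rintro e he f hf
  have key : ∀ {e : Edge m}, EndsAt e u v →
      (childV e = v ∧ depth v = depth u + 1) ∨ (childV e = u ∧ depth u = depth v + 1) := by
    rintro e (⟨h, h'⟩ | ⟨h, h'⟩)
    · exact Or.inl ⟨h', by rw [← h, ← h', depth_parentV, depth_childV]⟩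
    · exact Or.inr ⟨h', by rw [← h, ← h', depth_parentV, depth_childV]⟩
  rcases key he with ⟨h, h'⟩ | ⟨h, h'⟩ <;> rcases key hf with ⟨k, k'⟩ | ⟨k, k'⟩ <;>
    first
    | omega
    | exact Option.some.inj (h.trans k.symm)

/-- A coherent choice of one vertex at each depth is a ray. -/
lemma exists_ray_of_coherent (x : ℕ → V m) (hd : ∀ k, depth (x k) = k)
    (hx : ∀ k, up k (x (k + 1)) = x k) : ∃ ρ : Ray m, ∀ k, rayVtx ρ k = x k := by
  have hex : ∀ k, ∃ e, x (k + 1) = some e := fun k => by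
    rcases h : x (k + 1) with _ | e
    · have := hd (k + 1)
      rw [h] at this
      simp [depth] at this
    · exact ⟨e, rfl⟩
  choose e he using hex
  have hl : ∀ k, (e k).2.length = k := fun k => by
    have := hd (k + 1)
    rw [he] at this
    simpa [depth] using this
  have hs : ∀ k, ((e (k + 1)).1, (e (k + 1)).2.take k) = e k := fun k => by
    have := hx (k + 1)
    rw [he, he] at this
    simpa [up] using this
  let a : ℕ → Fin m := fun k => (e (k + 1)).2[k]'(by simp [hl])
  have main : ∀ k, rayEdge ((e 0).1, a) k = e k := by
    intro k
    induction k with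
    | zero =>
      refine Prod.ext rfl ?_
      simpa [rayEdge] using (List.length_eq_zero_iff.1 (hl 0)).symm
    | succ k ih =>
      have h1 := hs k
      rw [← ih] at h1
      refine Prod.ext (congrArg Prod.fst h1).symm ?_
      have h2 : (e (k + 1)).2.take k = List.ofFn fun i : Fin k => a i := congrArg Prod.snd h1
      have h3 : (e (k + 1)).2 = (e (k + 1)).2.take k ++ [a k] := by
        rw [List.take_append_getElem]
        exact (List.take_of_length_le (by simp [hl])).symm
      rw [h3, h2]
      simp only [rayEdge]
      rw [List.ofFn_succ', List.concat_eq_append]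
      rfl
  refine ⟨((e 0).1, a), fun k => ?_⟩
  rcases k with _ | k
  · exact (eq_none_of_depth (hd 0)).symm
  · exact (congrArg some (main k)).trans (he k).symm

/-- A sequence of vertices each of which is a child of the preceding one follows a ray. -/
lemma exists_ray_of_forward (w : ℕ → V m)
    (hw : ∀ n, ∃ e : Edge m, parentV e = w n ∧ childV e = w (n + 1)) :
    ∃ ρ : Ray m, ∀ n, w n = rayVtx ρ (depth (w 0) + n) := by
  have hd : ∀ n, depth (w n) = depth (w 0) + n := by
    intro n
    induction n with
    | zero => rfl
    | succ n ih =>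
      obtain ⟨e, h, h'⟩ := hw n
      rw [← h', depth_childV, ← depth_parentV, h, ih]
      rfl
  have hup : ∀ n, up (depth (w 0) + n) (w (n + 1)) = w n := by
    intro n
    obtain ⟨e, h, h'⟩ := hw n
    rw [← hd, ← h, depth_parentV, ← h', parentV_eq_up]
    rfl
  have hup' : ∀ j n, up (depth (w 0) + n) (w (n + j)) = w n := by
    intro j
    induction j with
    | zero => exact fun n => up_of_depth_le (hd n).le
    | succ j ih =>
      intro n
      rw [← ih n, ← hup (n + j), up_up, ← add_assoc]
      congr 1
      omega
  obtain ⟨ρ, hρ⟩ := exists_ray_of_coherent (fun k => up k (w k))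
    (fun k => by rw [depth_up, hd]; omega)
    (fun k => by
      have h := hup k
      simp only [up_up]
      rw [← hup k, up_up]
      congr 1
      omega)
  refine ⟨ρ, fun n => ?_⟩
  rw [hρ, add_comm (depth _) n]
  simpa [add_comm] using (hup' (depth (w 0)) n).symm

/-- From its `M`-th vertex on, the path `π` runs along `ρ`, starting at depth `D`. -/
def Follows {x : V m} (π : IPath m x) (M D : ℕ) (ρ : Ray m) : Prop :=
  ∀ n, π.vtx (M + n) = rayVtx ρ (D + n)

lemma Follows.mem_edges_iff {x : V m} {π : IPath m x} {M D : ℕ} {ρ : Ray m}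
    (h : Follows π M D ρ) (e : Edge m) :
    e ∈ π.edges ↔ (∃ n < M, EndsAt e (π.vtx n) (π.vtx (n + 1))) ∨ ∃ k ≥ D, e = rayEdge ρ k := by
  have key : ∀ n, EndsAt e (π.vtx (M + n)) (π.vtx (M + n + 1)) ↔ e = rayEdge ρ (D + n) := by
    intro n
    rw [← endsAt_ray_iff, add_assoc M, h, h]
    rfl
  constructor
  · rintro ⟨n, hn⟩
    rcases lt_or_ge n M with hlt | hge
    · exact Or.inl ⟨n, hlt, hn⟩
    · obtain ⟨j, rfl⟩ := Nat.exists_eq_add_of_le hge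
      exact Or.inr ⟨D + j, by omega, (key j).1 hn⟩
  · rintro (⟨n, -, hn⟩ | ⟨k, hk, hn⟩)
    · exact ⟨n, hn⟩
    · obtain ⟨j, rfl⟩ := Nat.exists_eq_add_of_le hk
      exact ⟨M + j, (key j).2 hn⟩

lemma finite_initial_edges {x : V m} (π : IPath m x) (M : ℕ) :
    {e | ∃ n < M, EndsAt e (π.vtx n) (π.vtx (n + 1))}.Finite := by
  have : {e | ∃ n < M, EndsAt e (π.vtx n) (π.vtx (n + 1))} =
      ⋃ n ∈ Set.Iio M, {e | EndsAt e (π.vtx n) (π.vtx (n + 1))} := by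
    ext; simp
  rw [this]
  exact (Set.finite_Iio M).biUnion fun n _ => (endsAt_subsingleton _ _).finite

lemma ray_eq_of_finite_diff {ρ σ : Ray m} (h : (rayEdges ρ \ rayEdges σ).Finite) : ρ = σ := by
  by_contra hne
  obtain ⟨n, hn⟩ : ∃ n, rayVtx ρ n ≠ rayVtx σ n := by
    by_contra! hall
    exact hne (ray_ext hall)
  refine ((Set.Ici_infinite n).image (rayEdge_injective ρ).injOn).mono ?_ h
  rintro _ ⟨k, hk, rfl⟩
  refine ⟨⟨k, rfl⟩, ?_⟩
  rintro ⟨j, hj⟩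
  have hv : rayVtx σ (j + 1) = rayVtx ρ (k + 1) := congrArg some hj
  have hjk : j = k := by simpa using congrArg depth hv
  subst hjk
  have hk' : n ≤ j + 1 := Nat.le_succ_of_le hk
  exact hn (by rw [← up_rayVtx ρ hk', ← up_rayVtx σ hk', hv])

lemma Follows.assoc_iff {x : V m} {π : IPath m x} {M D : ℕ} {ρ : Ray m}
    (h : Follows π M D ρ) (σ : Ray m) : Assoc π σ ↔ σ = ρ := by
  have h1 : (π.edges \ rayEdges ρ).Finite := by
    refine (finite_initial_edges π M).subset ?_
    rintro e ⟨he, he'⟩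
    rcases (h.mem_edges_iff e).1 he with h' | ⟨k, -, rfl⟩
    · exact h'
    · exact absurd ⟨k, rfl⟩ he'
  have h2 : (rayEdges ρ \ π.edges).Finite := by
    refine ((Set.finite_Iio D).image (rayEdge ρ)).subset ?_
    rintro _ ⟨⟨k, rfl⟩, he'⟩
    refine ⟨k, ?_, rfl⟩
    by_contra hk
    exact he' ((h.mem_edges_iff _).2 (Or.inr ⟨k, not_lt.1 hk, rfl⟩))
  constructor
  · intro ha
    have ha' : ((π.edges \ rayEdges σ) ∪ (rayEdges σ \ π.edges)).Finite := ha
    refine ray_eq_of_finite_diff ((ha'.union h1).subset ?_)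
    rintro e ⟨he, he'⟩
    by_cases hp : e ∈ π.edges
    · exact Or.inr ⟨hp, he'⟩
    · exact Or.inl (Or.inr ⟨he, hp⟩)
  · rintro rfl
    exact h1.union h2

lemma Follows.assoc {x : V m} {π : IPath m x} {M D : ℕ} {ρ : Ray m}
    (h : Follows π M D ρ) : Assoc π ρ := (h.assoc_iff ρ).2 rfl

lemma IPath.Forward.exists_follows {x : V m} {π : IPath m x} (h : π.Forward) :
    ∃ ρ, Follows π 0 (depth x) ρ := by
  obtain ⟨ρ, hρ⟩ := exists_ray_of_forward π.vtx h
  refine ⟨ρ, fun n => ?_⟩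
  rw [zero_add, hρ, π.start]

/-- A self-avoiding path cannot turn back: it never approaches the root after a step away
from it. -/
lemma IPath.forward_succ {x : V m} (π : IPath m x) {n : ℕ}
    (h : ∃ e : Edge m, parentV e = π.vtx n ∧ childV e = π.vtx (n + 1)) :
    ∃ e : Edge m, parentV e = π.vtx (n + 1) ∧ childV e = π.vtx (n + 1 + 1) := by
  obtain ⟨e, he, he'⟩ := h
  obtain ⟨f, hf | ⟨hf, hf'⟩⟩ := π.adj (n + 1)
  · exact ⟨f, hf⟩
  · obtain rfl : e = f := Option.some.inj (he'.trans hf'.symm)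
    have := π.inj (he.symm.trans hf)
    omega

lemma IPath.forward_of_first {x : V m} (π : IPath m x)
    (h : ∃ e : Edge m, parentV e = π.vtx 0 ∧ childV e = π.vtx 1) : π.Forward := by
  intro n
  induction n with
  | zero => exact h
  | succ n ih => exact π.forward_succ ih

lemma IPath.exists_forward_step {x : V m} (π : IPath m x) :
    ∃ n, ∃ e : Edge m, parentV e = π.vtx n ∧ childV e = π.vtx (n + 1) := by
  by_contra! hno
  have hd : ∀ n, depth (π.vtx n) + n = depth (π.vtx 0) := by
    intro n
    induction n with
    | zero => rfl
    | succ n ih =>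
      obtain ⟨f, ⟨hf, hf'⟩ | ⟨hf, hf'⟩⟩ := π.adj n
      · exact absurd hf' (hno n f hf)
      · rw [← ih, ← hf', ← hf, depth_parentV, depth_childV]
        omega
  have := hd (depth (π.vtx 0) + 1)
  omega

/-- Every infinite path eventually follows a ray, and it reaches any sufficiently large depth
`D` for the first time when it already follows this ray. -/
lemma IPath.exists_follows {x : V m} (π : IPath m x) :
    ∃ (ρ : Ray m) (D₀ : ℕ), ∀ D ≥ D₀, ∃ M, (∀ i < M, depth (π.vtx i) < D) ∧ Follows π M D ρ := by
  obtain ⟨N, hN⟩ := π.exists_forward_step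
  have hfwd : ∀ n, ∃ e : Edge m, parentV e = π.vtx (N + n) ∧ childV e = π.vtx (N + n + 1) := by
    intro n
    induction n with
    | zero => exact hN
    | succ n ih => exact π.forward_succ ih
  obtain ⟨ρ, hρ⟩ := exists_ray_of_forward (fun n => π.vtx (N + n)) hfwd
  simp only [add_zero] at hρ
  refine ⟨ρ, (Finset.range (N + 1)).sup (fun i => depth (π.vtx i)) + 1, fun D hD => ?_⟩
  have hle : ∀ i ≤ N, depth (π.vtx i) < D := fun i hi =>
    lt_of_lt_of_le (Nat.lt_succ_of_le
      (Finset.le_sup (f := fun i => depth (π.vtx i)) (Finset.mem_range_succ_iff.2 hi))) hD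
  have hND := hle N le_rfl
  refine ⟨N + (D - depth (π.vtx N)), fun i hi => ?_, fun n => ?_⟩
  · rcases le_or_gt i N with h | h
    · exact hle i h
    · obtain ⟨j, rfl⟩ := Nat.exists_eq_add_of_le h.le
      rw [hρ, depth_rayVtx]
      omega
  · rw [add_assoc, hρ]
    congr 1
    omega

/-- The ray `ρ` passes through `u` and all its edges beyond `u` are open. -/
def OpenFrom (ω : Config m) (u : V m) (ρ : Ray m) : Prop :=
  rayVtx ρ (depth u) = u ∧ ∀ k ≥ depth u, ω (rayEdge ρ k) = true

/-- The part of the ray `ρ` beyond its vertex `u`. -/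
def tailPath (ρ : Ray m) (u : V m) (h : rayVtx ρ (depth u) = u) : IPath m u where
  vtx n := rayVtx ρ (depth u + n)
  start := h
  inj a b hab := by simpa using congrArg depth hab
  adj n := ⟨rayEdge ρ (depth u + n), (endsAt_ray_iff _ _ _).2 rfl⟩

lemma tailPath_follows (ρ : Ray m) (u : V m) (h : rayVtx ρ (depth u) = u) :
    Follows (tailPath ρ u h) 0 (depth u) ρ := fun n => by
  rw [zero_add]; rfl

lemma tailPath_forward (ρ : Ray m) (u : V m) (h : rayVtx ρ (depth u) = u) :
    (tailPath ρ u h).Forward := fun n =>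
  ⟨rayEdge ρ (depth u + n), parentV_rayEdge _ _, rfl⟩

lemma mem_edges_of_follows_zero {u : V m} {π : IPath m u} {D : ℕ} {ρ : Ray m}
    (h : Follows π 0 D ρ) (e : Edge m) : e ∈ π.edges ↔ ∃ k ≥ D, e = rayEdge ρ k := by
  rw [h.mem_edges_iff]
  simp

lemma IPath.openFrom {u : V m} {π : IPath m u} {ρ : Ray m} {ω : Config m}
    (h : Follows π 0 (depth u) ρ) (ho : OpenPath ω π) : OpenFrom ω u ρ :=
  ⟨(h 0).symm.trans π.start,
    fun k hk => ho _ ((mem_edges_of_follows_zero h _).2 ⟨k, hk, rfl⟩)⟩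

lemma OpenFrom.openPath {u : V m} {ρ : Ray m} {ω : Config m} (h : OpenFrom ω u ρ) :
    OpenPath ω (tailPath ρ u h.1) := fun e he => by
  obtain ⟨k, hk, rfl⟩ := (mem_edges_of_follows_zero (tailPath_follows ρ u h.1) e).1 he
  exact h.2 k hk

lemma mem_AEvent_iff (S : Ray m → Ray m → Prop) (u v : V m) (ω : Config m) :
    ω ∈ AEvent S u v ↔ ∃ ρ σ, OpenFrom ω u ρ ∧ OpenFrom ω v σ ∧ S ρ σ := by
  constructor
  · rintro ⟨πu, πv, hu, hv, hou, hov, ρ, σ, hρ, hσ, hS⟩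
    obtain ⟨ρ', hρ'⟩ := hu.exists_follows
    obtain ⟨σ', hσ'⟩ := hv.exists_follows
    obtain rfl := (hρ'.assoc_iff ρ).1 hρ
    obtain rfl := (hσ'.assoc_iff σ).1 hσ
    exact ⟨ρ, σ, IPath.openFrom hρ' hou, IPath.openFrom hσ' hov, hS⟩
  · rintro ⟨ρ, σ, hρ, hσ, hS⟩
    exact ⟨tailPath ρ u hρ.1, tailPath σ v hσ.1, tailPath_forward _ _ _, tailPath_forward _ _ _,
      hρ.openPath, hσ.openPath, ρ, σ, (tailPath_follows _ _ _).assoc,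
      (tailPath_follows _ _ _).assoc, hS⟩

lemma measurableSet_forall_open (F : Set (Edge m)) :
    MeasurableSet {ω : Config m | ∀ e ∈ F, ω e = true} := by
  have : {ω : Config m | ∀ e ∈ F, ω e = true} = ⋂ e ∈ F, (fun ω => ω e) ⁻¹' {true} := by
    ext; simp
  rw [this]
  exact MeasurableSet.biInter F.to_countable fun e _ =>
    measurable_pi_apply e (measurableSet_singleton true)

lemma isOpen_rayEdge_eq (k : ℕ) (e : Edge m) : IsOpen {ρ : Ray m | rayEdge ρ k = e} := by
  let f : Ray m → Fin (m + 1) × (Fin k → Fin m) := fun ρ => (ρ.1, fun j => ρ.2 j)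
  have hf : Continuous f := by fun_prop
  exact (isOpen_discrete {x : Fin (m + 1) × (Fin k → Fin m) | (x.1, List.ofFn x.2) = e}).preimage hf

lemma isClosed_open_rayEdge (k : ℕ) :
    IsClosed {p : Config m × Ray m | p.1 (rayEdge p.2 k) = true} := by
  have : {p : Config m × Ray m | p.1 (rayEdge p.2 k) = true}ᶜ =
      ⋃ e : Edge m, {ω : Config m | ω e = false} ×ˢ {ρ : Ray m | rayEdge ρ k = e} := by
    ext p; simp
  rw [← isOpen_compl_iff, this]
  refine isOpen_iUnion fun e => IsOpen.prod ?_ (isOpen_rayEdge_eq k e)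
  exact (isOpen_discrete ({false} : Set Bool)).preimage (continuous_apply (A := fun _ => Bool) e)

lemma isClosed_through (v : V m) : IsClosed {ρ : Ray m | rayVtx ρ (depth v) = v} := by
  rcases v with _ | e
  · simp [depth, rayVtx]
  · have : {ρ : Ray m | rayVtx ρ (depth (some e)) = some e} =
        (⋃ f ∈ ({e}ᶜ : Set (Edge m)), {ρ : Ray m | rayEdge ρ e.2.length = f})ᶜ := by
      ext ρ
      simp only [depth, rayVtx, Option.some.injEq, Set.mem_ofPred_eq, Set.mem_compl_iff,
        Set.mem_iUnion, Set.mem_singleton_iff, exists_prop, exists_eq_right', not_not]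
    rw [this]
    exact (isOpen_biUnion fun f _ => isOpen_rayEdge_eq _ f).isClosed_compl

lemma measurableSet_exists_openFrom (v : V m) :
    MeasurableSet {ω : Config m | ∃ ρ, OpenFrom ω v ρ} := by
  let C : Set (Config m × Ray m) := {p | OpenFrom p.1 v p.2}
  have hC : IsClosed C := by
    have : C = Prod.snd ⁻¹' {ρ : Ray m | rayVtx ρ (depth v) = v} ∩
        ⋂ k ≥ depth v, {p : Config m × Ray m | p.1 (rayEdge p.2 k) = true} := by
      ext p; simp [C, OpenFrom]
    rw [this]
    exact ((isClosed_through v).preimage continuous_snd).inter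
      (isClosed_biInter fun k _ => isClosed_open_rayEdge k)
  have : {ω : Config m | ∃ ρ, OpenFrom ω v ρ} = Prod.fst '' C := by
    ext ω; simp [C]
  rw [this]
  exact (isClosedMap_fst_of_compactSpace C hC).measurableSet

lemma AEvent_comm (S : Ray m → Ray m → Prop) (hsymm : ∀ ρ₁ ρ₂, S ρ₁ ρ₂ → S ρ₂ ρ₁) (u v : V m) :
    AEvent S u v = AEvent S v u := by
  ext ω
  rw [mem_AEvent_iff, mem_AEvent_iff]
  constructor <;> rintro ⟨ρ, σ, hρ, hσ, hS⟩ <;> exact ⟨σ, ρ, hσ, hρ, hsymm _ _ hS⟩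

lemma measurableSet_AEvent_self (S : Ray m → Ray m → Prop) (hrefl : ∀ ρ, S ρ ρ) (v : V m) :
    MeasurableSet (AEvent S v v) := by
  convert measurableSet_exists_openFrom v using 1
  ext ω
  rw [mem_AEvent_iff]
  exact ⟨fun ⟨ρ, _, hρ, _, _⟩ => ⟨ρ, hρ⟩, fun ⟨ρ, hρ⟩ => ⟨ρ, ρ, hρ, hρ, hrefl ρ⟩⟩

/-- The edges on the path from the root to `u`. -/
def above (u : V m) : Set (Edge m) := {e | up (e.2.length + 1) u = some e}

@[simp] lemma length_rayEdge (ρ : Ray m) (k : ℕ) : (rayEdge ρ k).2.length = k := by simp [rayEdge]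

lemma rayEdge_mem_above {ρ : Ray m} {k : ℕ} {u : V m} :
    rayEdge ρ k ∈ above u ↔ up (k + 1) u = rayVtx ρ (k + 1) := by
  simp [above, rayVtx]

lemma length_lt_of_mem_above {e : Edge m} {u : V m} (h : e ∈ above u) : e.2.length < depth u := by
  have := congrArg depth h
  rw [depth_up] at this
  simp only [depth_some] at this
  omega

lemma mem_above_iff {ρ : Ray m} {u : V m} (hu : rayVtx ρ (depth u) = u) (e : Edge m) :
    e ∈ above u ↔ ∃ k < depth u, e = rayEdge ρ k := by
  constructor
  · intro h
    have hlt := length_lt_of_mem_above h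
    refine ⟨e.2.length, hlt, ((rayEdge_eq_iff _ _ _).2 ?_).symm⟩
    have h' : up (e.2.length + 1) u = some e := h
    rw [← h']
    conv_rhs => rw [← hu]
    exact (up_rayVtx ρ hlt).symm
  · rintro ⟨k, hk, rfl⟩
    rw [rayEdge_mem_above]
    conv_lhs => rw [← hu]
    exact up_rayVtx ρ hk

lemma openRay_iff {ω : Config m} {ρ : Ray m} {u : V m} (hu : rayVtx ρ (depth u) = u) :
    OpenRay ω ρ ↔ OpenFrom ω u ρ ∧ ∀ e ∈ above u, ω e = true := by
  constructor
  · intro h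
    refine ⟨⟨hu, fun k _ => h k⟩, fun e he => ?_⟩
    obtain ⟨k, -, rfl⟩ := (mem_above_iff hu e).1 he
    exact h k
  · rintro ⟨h, h'⟩ k
    rcases lt_or_ge k (depth u) with hk | hk
    · exact h' _ ((mem_above_iff hu _).2 ⟨k, hk, rfl⟩)
    · exact h.2 k hk

lemma APrimeEvent_eq (S : Ray m → Ray m → Prop) (u v : V m) :
    APrimeEvent S u v = AEvent S u v ∩ {ω | ∀ e ∈ above u ∪ above v, ω e = true} := by
  ext ω
  simp only [APrimeEvent, rayThrough_iff, Set.mem_inter_iff, mem_AEvent_iff, Set.mem_ofPred_eq]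
  constructor
  · rintro ⟨ρ, σ, hu, hv, hρ, hσ, hS⟩
    rw [openRay_iff hu] at hρ
    rw [openRay_iff hv] at hσ
    exact ⟨⟨ρ, σ, hρ.1, hσ.1, hS⟩, fun e he => he.elim (hρ.2 e) (hσ.2 e)⟩
  · rintro ⟨⟨ρ, σ, hρ, hσ, hS⟩, h⟩
    exact ⟨ρ, σ, hρ.1, hσ.1, (openRay_iff hρ.1).2 ⟨hρ, fun e he => h e (Or.inl he)⟩,
      (openRay_iff hσ.1).2 ⟨hσ, fun e he => h e (Or.inr he)⟩, hS⟩

lemma rayEdge_notMem_above_self {ρ : Ray m} {u : V m} {k : ℕ} (hk : depth u ≤ k) :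
    rayEdge ρ k ∉ above u := fun h => by
  have := length_lt_of_mem_above h
  rw [length_rayEdge] at this
  omega

lemma rayEdge_notMem_above {ρ : Ray m} {u v : V m} (hρ : rayVtx ρ (depth u) = u)
    (huv : up (depth u) v ≠ u) {k : ℕ} (hk : depth u ≤ k) : rayEdge ρ k ∉ above v := fun h => by
  rw [rayEdge_mem_above] at h
  have := congrArg (up (depth u)) h
  rw [up_up, up_rayVtx ρ (by omega), hρ, min_eq_left (by omega)] at this
  exact huv this

open Classical in
/-- The configuration in which the edges of `P` are opened, those of `B` are left unchanged,
and all others are closed. -/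
noncomputable def pin (P B : Set (Edge m)) (ω : Config m) : Config m :=
  fun e => decide (e ∈ P ∨ e ∈ B ∧ ω e = true)

lemma pin_eq_true {P B : Set (Edge m)} {ω : Config m} {e : Edge m} :
    pin P B ω e = true ↔ e ∈ P ∨ e ∈ B ∧ ω e = true := by
  simp [pin]

lemma measurable_pin (P B : Set (Edge m)) : Measurable (pin P B) := by
  refine measurable_pi_iff.2 fun e => ?_
  by_cases hP : e ∈ P
  · simp [pin, hP]
  · by_cases hB : e ∈ B
    · simpa [pin, hP, hB] using measurable_pi_apply e
    · simp [pin, hP, hB]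

lemma measurableSet_AEvent_of_APrimeEvent (S : Ray m → Ray m → Prop) {u v : V m}
    (huv : up (depth u) v ≠ u) (hvu : up (depth v) u ≠ v)
    (h : MeasurableSet (APrimeEvent S u v)) : MeasurableSet (AEvent S u v) := by
  convert measurable_pin (above u ∪ above v) Set.univ h using 1
  ext ω
  simp only [Set.mem_preimage, APrimeEvent_eq, Set.mem_inter_iff, mem_AEvent_iff, OpenFrom,
    Set.mem_ofPred_eq, pin_eq_true, Set.mem_univ, true_and]
  constructor
  · rintro ⟨ρ, σ, hρ, hσ, hS⟩
    exact ⟨⟨ρ, σ, ⟨hρ.1, fun k hk => Or.inr (hρ.2 k hk)⟩, ⟨hσ.1, fun k hk => Or.inr (hσ.2 k hk)⟩,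
      hS⟩, fun e he => Or.inl he⟩
  · rintro ⟨⟨ρ, σ, hρ, hσ, hS⟩, -⟩
    refine ⟨ρ, σ, ⟨hρ.1, fun k hk => (hρ.2 k hk).resolve_left ?_⟩,
      ⟨hσ.1, fun k hk => (hσ.2 k hk).resolve_left ?_⟩, hS⟩
    · exact not_or.2 ⟨rayEdge_notMem_above_self hk, rayEdge_notMem_above hρ.1 huv hk⟩
    · exact not_or.2 ⟨rayEdge_notMem_above hσ.1 hvu hk, rayEdge_notMem_above_self hk⟩

lemma not_comparable_iff (u v : V m) :
    ¬ Comparable u v ↔ up (depth u) v ≠ u ∧ up (depth v) u ≠ v := by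
  simp [Comparable, anc_iff]

lemma not_comparable_of_depth_eq {u v : V m} (h : depth u = depth v) (hne : u ≠ v) :
    ¬ Comparable u v := by
  rw [not_comparable_iff, h, up_of_depth_le le_rfl, up_of_depth_le h.le]
  exact ⟨hne.symm, hne⟩

/-- If `u` is an ancestor of `v`, then a ray from `u` is split at the depth of `v`. -/
lemma AEvent_eq_iUnion (S : Ray m → Ray m → Prop) {u v : V m} (h : up (depth u) v = u) :
    AEvent S u v = ⋃ w ∈ {w : V m | depth w = depth v ∧ up (depth u) w = u},
      ({ω | ∀ e ∈ above w ∩ {e | depth u ≤ e.2.length}, ω e = true} ∩ AEvent S w v) := by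
  have hle : depth u ≤ depth v := by
    have := congrArg depth h
    rw [depth_up] at this
    omega
  ext ω
  simp only [Set.mem_iUnion, Set.mem_inter_iff, mem_AEvent_iff, Set.mem_ofPred_eq, exists_prop]
  constructor
  · rintro ⟨ρ, σ, hρ, hσ, hS⟩
    refine ⟨rayVtx ρ (depth v), ⟨depth_rayVtx _ _, (up_rayVtx ρ hle).trans hρ.1⟩, ?_, ρ, σ,
      ⟨by simp, fun k hk => hρ.2 k ?_⟩, hσ, hS⟩
    · rintro e ⟨he, he'⟩
      obtain ⟨k, -, rfl⟩ := (mem_above_iff (ρ := ρ) (by simp) e).1 he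
      rw [length_rayEdge] at he'
      exact hρ.2 k he'
    · rw [depth_rayVtx] at hk
      exact hle.trans hk
  · rintro ⟨w, ⟨hw, hw'⟩, hopen, ρ, σ, hρ, hσ, hS⟩
    refine ⟨ρ, σ, ⟨?_, fun k hk => ?_⟩, hσ, hS⟩
    · rw [← up_rayVtx ρ (hle.trans hw.ge), hρ.1, hw']
    · rcases lt_or_ge k (depth w) with hkw | hkw
      · exact hopen _ ⟨(mem_above_iff hρ.1 _).2 ⟨k, hkw, rfl⟩, by simpa using hk⟩
      · exact hρ.2 k hkw

lemma measurableSet_AEvent_of_incomparable (S : Ray m → Ray m → Prop)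
    (hrefl : ∀ ρ, S ρ ρ) (hsymm : ∀ ρ₁ ρ₂, S ρ₁ ρ₂ → S ρ₂ ρ₁)
    (h : ∀ u v : V m, ¬ Comparable u v → MeasurableSet (AEvent S u v)) (u v : V m) :
    MeasurableSet (AEvent S u v) := by
  have key : ∀ u v : V m, up (depth u) v = u → MeasurableSet (AEvent S u v) := by
    intro u v huv
    rw [AEvent_eq_iUnion S huv]
    refine MeasurableSet.biUnion (Set.to_countable _) fun w hw =>
      (measurableSet_forall_open _).inter ?_
    by_cases hwv : w = v
    · exact hwv ▸ measurableSet_AEvent_self S hrefl w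
    · exact h w v (not_comparable_of_depth_eq hw.1 hwv)
  by_cases hc : Comparable u v
  · rcases hc with hc | hc
    · exact key u v ((anc_iff u v).1 hc)
    · rw [AEvent_comm S hsymm]
      exact key v u ((anc_iff v u).1 hc)
  · exact h u v hc

/-- The path that follows `π` up to its `M`-th vertex and the ray `ρ` afterwards. -/
def IPath.splice {x : V m} (π : IPath m x) (M D : ℕ) (ρ : Ray m)
    (hlt : ∀ i < M, depth (π.vtx i) < D) (hM : π.vtx M = rayVtx ρ D) : IPath m x where
  vtx n := if n < M then π.vtx n else rayVtx ρ (D + (n - M))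
  start := by
    split_ifs with h
    · exact π.start
    · obtain rfl : M = 0 := by omega
      simpa [π.start] using hM.symm
  inj a b hab := by
    dsimp only at hab
    split_ifs at hab with ha hb hb
    · exact π.inj hab
    · have := hlt a ha
      rw [hab, depth_rayVtx] at this
      omega
    · have := hlt b hb
      rw [← hab, depth_rayVtx] at this
      omega
    · have := congrArg depth hab
      simp only [depth_rayVtx] at this
      omega
  adj n := by
    split_ifs with h h' h'
    · exact π.adj n
    · obtain rfl : M = n + 1 := by omega
      simpa [← hM] using π.adj n
    · omega
    · refine ⟨rayEdge ρ (D + (n - M)), ?_⟩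
      have : D + (n + 1 - M) = D + (n - M) + 1 := by omega
      rw [this]
      exact (endsAt_ray_iff _ _ _).2 rfl

section Splice

variable {x : V m} (π : IPath m x) (M D : ℕ) (ρ : Ray m)
  (hlt : ∀ i < M, depth (π.vtx i) < D) (hM : π.vtx M = rayVtx ρ D)

lemma IPath.splice_vtx_of_le {n : ℕ} (hn : n ≤ M) :
    (π.splice M D ρ hlt hM).vtx n = π.vtx n := by
  rcases hn.lt_or_eq with h | rfl
  · simp [splice, h]
  · simp [splice, hM]

lemma IPath.splice_follows : Follows (π.splice M D ρ hlt hM) M D ρ := fun n => by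
  simp [splice]

lemma IPath.mem_splice_edges_iff (e : Edge m) : e ∈ (π.splice M D ρ hlt hM).edges ↔
    (∃ n < M, EndsAt e (π.vtx n) (π.vtx (n + 1))) ∨ ∃ k ≥ D, e = rayEdge ρ k := by
  rw [(π.splice_follows M D ρ hlt hM).mem_edges_iff]
  refine or_congr (exists_congr fun n => and_congr_right fun hn => ?_) Iff.rfl
  rw [π.splice_vtx_of_le M D ρ hlt hM hn.le, π.splice_vtx_of_le M D ρ hlt hM hn]

end Splice

lemma splice_disjoint {u v : V m} (π : IPath m u) (τ : IPath m v) (M N D : ℕ) (ρ σ : Ray m)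
    (hπ : ∀ i < M, depth (π.vtx i) < D) (hM : π.vtx M = rayVtx ρ D)
    (hτ : ∀ i < N, depth (τ.vtx i) < D) (hN : τ.vtx N = rayVtx σ D)
    (hdisj : ∀ a b, π.vtx a ≠ τ.vtx b) (a b : ℕ) :
    (π.splice M D ρ hπ hM).vtx a ≠ (τ.splice N D σ hτ hN).vtx b := by
  intro hab
  simp only [IPath.splice] at hab
  split_ifs at hab with ha hb hb
  · exact hdisj a b hab
  · have := hπ a ha
    rw [hab, depth_rayVtx] at this
    omega
  · have := hτ b hb
    rw [← hab, depth_rayVtx] at this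
    omega
  · have := congrArg (up D) hab
    rw [up_rayVtx _ (by omega), up_rayVtx _ (by omega), ← hM, ← hN] at this
    exact hdisj M N this

/-- Open edge sets `P`, `Q` and any two rays through the vertices `x` and `y` suffice for the
existence of two disjoint paths from `u` and `v` as in the definition of `KEvent`. -/
def Extendable (Λ : Set (V m)) (u v : V m) (i : Finset (Edge m) × Finset (Edge m) × V m × V m) :
    Prop :=
  ¬ Comparable i.2.2.1 i.2.2.2 ∧
  ∀ ρ σ : Ray m, rayVtx ρ (depth i.2.2.1) = i.2.2.1 → rayVtx σ (depth i.2.2.2) = i.2.2.2 →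
    ∃ (πu : IPath m u) (πv : IPath m v), (∀ a b, πu.vtx a ≠ πv.vtx b) ∧
      (∀ e ∈ πu.edges, e ∉ ELam Λ) ∧ (∀ e ∈ πv.edges, e ∉ ELam Λ) ∧
      (∀ e ∈ πu.edges, e ∈ i.1 ∨ ∃ k ≥ depth i.2.2.1, e = rayEdge ρ k) ∧
      (∀ e ∈ πv.edges, e ∈ i.2.1 ∨ ∃ k ≥ depth i.2.2.2, e = rayEdge σ k) ∧
      Assoc πu ρ ∧ Assoc πv σ

lemma rayEdge_notMem_ELam {Λ : Set (V m)} {D k : ℕ} (hΛ : ∀ w ∈ Λ, depth w ≤ D) (hk : D ≤ k)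
    (ρ : Ray m) : rayEdge ρ k ∉ ELam Λ := fun h => by
  have := hΛ _ h.2
  rw [childV_rayEdge, depth_rayVtx] at this
  omega

lemma KEvent_eq_iUnion (S : Ray m → Ray m → Prop) {Λ : Set (V m)} (hΛ : Λ.Finite) (u v : V m) :
    KEvent S Λ u v = ⋃ i ∈ {i | Extendable Λ u v i},
      ({ω | ∀ e ∈ (i.1 : Set (Edge m)) ∪ i.2.1, ω e = true} ∩ AEvent S i.2.2.1 i.2.2.2) := by
  ext ω
  simp only [Set.mem_iUnion, Set.mem_inter_iff, mem_AEvent_iff, Set.mem_ofPred_eq, exists_prop]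
  constructor
  · rintro ⟨πu, πv, hdisj, hou, hov, hlu, hlv, ρ, σ, hρ, hσ, hS⟩
    obtain ⟨ρ', D₁, hD₁⟩ := πu.exists_follows
    obtain ⟨σ', D₂, hD₂⟩ := πv.exists_follows
    obtain ⟨D₃, hD₃⟩ := (hΛ.image depth).bddAbove
    obtain ⟨M, hltM, hM⟩ := hD₁ (max (max D₁ D₂) D₃) (by omega)
    obtain ⟨N, hltN, hN⟩ := hD₂ (max (max D₁ D₂) D₃) (by omega)
    have hΛD : ∀ w ∈ Λ, depth w ≤ max (max D₁ D₂) D₃ := fun w hw =>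
      (hD₃ ⟨w, hw, rfl⟩).trans (le_max_right _ _)
    generalize max (max D₁ D₂) D₃ = D at *
    obtain rfl := (hM.assoc_iff ρ).1 hρ
    obtain rfl := (hN.assoc_iff σ).1 hσ
    have hM0 : πu.vtx M = rayVtx ρ D := hM 0
    have hN0 : πv.vtx N = rayVtx σ D := hN 0
    refine ⟨((finite_initial_edges πu M).toFinset, (finite_initial_edges πv N).toFinset,
      rayVtx ρ D, rayVtx σ D), ⟨?_, fun ρ' σ' hρ' hσ' => ?_⟩, ?_, ρ, σ, ?_, ?_, hS⟩
    · refine not_comparable_of_depth_eq (by simp) ?_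
      rw [← hM0, ← hN0]
      exact hdisj M N
    · simp only [depth_rayVtx] at hρ' hσ' ⊢
      have hMρ := hM0.trans hρ'.symm
      have hNσ := hN0.trans hσ'.symm
      refine ⟨πu.splice M D ρ' hltM hMρ, πv.splice N D σ' hltN hNσ,
        splice_disjoint _ _ _ _ _ _ _ _ _ _ _ hdisj, ?_, ?_, ?_, ?_,
        Follows.assoc (IPath.splice_follows πu _ _ _ _ _), Follows.assoc (IPath.splice_follows πv _ _ _ _ _)⟩
      · intro e he
        rcases (IPath.mem_splice_edges_iff ..).1 he with ⟨n, -, hn⟩ | ⟨k, hk, rfl⟩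
        · exact hlu e ⟨n, hn⟩
        · exact rayEdge_notMem_ELam hΛD hk ρ'
      · intro e he
        rcases (IPath.mem_splice_edges_iff ..).1 he with ⟨n, -, hn⟩ | ⟨k, hk, rfl⟩
        · exact hlv e ⟨n, hn⟩
        · exact rayEdge_notMem_ELam hΛD hk σ'
      · intro e he
        simpa using (IPath.mem_splice_edges_iff ..).1 he
      · intro e he
        simpa using (IPath.mem_splice_edges_iff ..).1 he
    · rintro e (he | he)
      · obtain ⟨n, -, hn⟩ := (Set.Finite.mem_toFinset _).1 he
        exact hou e ⟨n, hn⟩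
      · obtain ⟨n, -, hn⟩ := (Set.Finite.mem_toFinset _).1 he
        exact hov e ⟨n, hn⟩
    · refine ⟨by simp, fun k hk => hou _ ((hM.mem_edges_iff _).2 (Or.inr ⟨k, ?_, rfl⟩))⟩
      simpa using hk
    · refine ⟨by simp, fun k hk => hov _ ((hN.mem_edges_iff _).2 (Or.inr ⟨k, ?_, rfl⟩))⟩
      simpa using hk
  · rintro ⟨i, ⟨-, hi⟩, hopen, ρ, σ, hρ, hσ, hS⟩
    obtain ⟨πu, πv, hdisj, hlu, hlv, heu, hev, hau, hav⟩ := hi ρ σ hρ.1 hσ.1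
    refine ⟨πu, πv, hdisj, fun e he => ?_, fun e he => ?_, hlu, hlv, ρ, σ, hau, hav, hS⟩
    · rcases heu e he with h | ⟨k, hk, rfl⟩
      · exact hopen e (Or.inl h)
      · exact hρ.2 k hk
    · rcases hev e he with h | ⟨k, hk, rfl⟩
      · exact hopen e (Or.inr h)
      · exact hσ.2 k hk

lemma measurableSet_KEvent (S : Ray m → Ray m → Prop)
    (h : ∀ u v : V m, ¬ Comparable u v → MeasurableSet (AEvent S u v))
    {Λ : Set (V m)} (hΛ : Λ.Finite) (u v : V m) : MeasurableSet (KEvent S Λ u v) := by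
  rw [KEvent_eq_iUnion S hΛ]
  exact MeasurableSet.biUnion (Set.to_countable _) fun i hi =>
    (measurableSet_forall_open _).inter (h _ _ hi.1)

/-- Two incomparable vertices have a last common ancestor. -/
lemma exists_branch {u v : V m} (huv : up (depth u) v ≠ u) (hvu : up (depth v) u ≠ v) :
    ∃ d, d < depth u ∧ d < depth v ∧ up d u = up d v ∧ up (d + 1) u ≠ up (d + 1) v := by
  have hex : ∃ k, up k u ≠ up k v := ⟨depth u, fun h => huv (by
    rw [← h, up_of_depth_le le_rfl])⟩
  classical
  have hpos : Nat.find hex ≠ 0 := fun h0 => by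
    have := Nat.find_spec hex
    rw [h0] at this
    simp at this
  obtain ⟨d, hd⟩ := Nat.exists_eq_succ_of_ne_zero hpos
  have hne := Nat.find_spec hex
  rw [hd] at hne
  have heq : up d u = up d v := not_not.1 (Nat.find_min hex (by omega))
  refine ⟨d, ?_, ?_, heq, hne⟩
  · by_contra hle
    rw [up_of_depth_le (not_lt.1 hle)] at heq
    apply huv
    have := congrArg (up (depth u)) heq
    rwa [up_up, min_eq_left (not_lt.1 hle), up_of_depth_le le_rfl, eq_comm] at this
  · by_contra hle
    rw [up_of_depth_le (v := v) (not_lt.1 hle)] at heq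
    apply hvu
    have := congrArg (up (depth v)) heq
    rwa [up_up, min_eq_left (not_lt.1 hle), up_of_depth_le (v := v) le_rfl] at this

/-- The edges strictly below `u`. -/
def below (u : V m) : Set (Edge m) := {e | up (depth u) (some e) = u ∧ depth u ≤ e.2.length}

lemma rayEdge_mem_below {ρ : Ray m} {u : V m} {k : ℕ} :
    rayEdge ρ k ∈ below u ↔ depth u ≤ k ∧ rayVtx ρ (depth u) = u := by
  have : ∀ (hk : depth u ≤ k), up (depth u) (some (rayEdge ρ k)) = rayVtx ρ (depth u) :=
    fun hk => up_rayVtx (n := k + 1) ρ (by omega)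
  constructor
  · rintro ⟨h, h'⟩
    rw [length_rayEdge] at h'
    exact ⟨h', (this h').symm.trans h⟩
  · rintro ⟨h, h'⟩
    exact ⟨(this h).trans h', by simpa using h⟩

section Branch

variable {u v : V m} {P : Set (Edge m)} {ω : Config m} {ρ : Ray m}

lemma through_or_through (hP : P ⊆ above u ∪ above v) {x : V m}
    (h : OpenFrom (pin P (below u ∪ below v) ω) x ρ) :
    rayVtx ρ (depth u) = u ∨ rayVtx ρ (depth v) = v := by
  have hk := h.2 (depth x + depth u + depth v) (by omega)
  rcases pin_eq_true.1 hk with hk | ⟨hk | hk, -⟩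
  · rcases hP hk with hk | hk
    · exact absurd hk (rayEdge_notMem_above_self (by omega))
    · exact absurd hk (rayEdge_notMem_above_self (by omega))
  · exact Or.inl (rayEdge_mem_below.1 hk).2
  · exact Or.inr (rayEdge_mem_below.1 hk).2

lemma OpenFrom.of_pin (hP : P ⊆ above u ∪ above v) (huv : up (depth u) v ≠ u) {x : V m}
    (h : OpenFrom (pin P (below u ∪ below v) ω) x ρ) (hx : depth x ≤ depth u)
    (hu : rayVtx ρ (depth u) = u) : OpenFrom ω u ρ := by
  refine ⟨hu, fun k hk => ?_⟩
  rcases pin_eq_true.1 (h.2 k (hx.trans hk)) with h' | h'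
  · rcases hP h' with h' | h'
    · exact absurd h' (rayEdge_notMem_above_self hk)
    · exact absurd h' (rayEdge_notMem_above hu huv hk)
  · exact h'.2

end Branch

lemma IPath.forward_of_not_back {x : V m} (π : IPath m x)
    (h : ∀ e ∈ π.edges, childV e ≠ x) : π.Forward := by
  apply π.forward_of_first
  obtain ⟨e, he | he⟩ := π.adj 0
  · exact ⟨e, he⟩
  · exact absurd (he.2.trans π.start) (h e ⟨0, Or.inr he⟩)

lemma measurableSet_AEvent_of_KEvent (S : Ray m → Ray m → Prop)
    (h : ∀ e : Edge m, MeasurableSet (KEvent S {parentV e, childV e} (parentV e) (childV e)))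
    {u v : V m} (huv : up (depth u) v ≠ u) (hvu : up (depth v) u ≠ v) :
    MeasurableSet (AEvent S u v) := by
  obtain ⟨d, hdu, hdv, heq, hne⟩ := exists_branch huv hvu
  obtain ⟨e₀, he₀⟩ : ∃ e₀, up (d + 1) v = some e₀ := by
    rcases hv : up (d + 1) v with _ | e₀
    · have := congrArg depth hv
      rw [depth_up] at this
      change _ = 0 at this
      omega
    · exact ⟨e₀, rfl⟩
  have hlen : e₀.2.length = d := by
    have := congrArg depth he₀
    rw [depth_up] at this
    simp only [depth_some] at this
    omega
  have hchild : depth (childV e₀) = d + 1 := by rw [depth_childV, hlen]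
  have hparent : depth (parentV e₀) = d := by rw [depth_parentV, hlen]
  have hpar : parentV e₀ = up d v := by
    rw [parentV_eq_up, hlen, ← he₀, up_up, min_eq_left d.le_succ]
  let P : Set (Edge m) :=
    (above u ∩ {e | d ≤ e.2.length}) ∪ (above v ∩ {e | d + 1 ≤ e.2.length})
  have hP : P ⊆ above u ∪ above v :=
    Set.union_subset_union Set.inter_subset_left Set.inter_subset_left
  have hP' : P ⊆ above v ∪ above u := fun e he => (hP he).symm
  convert measurable_pin P (below u ∪ below v) (h e₀) using 1
  ext ω
  simp only [Set.mem_preimage, mem_AEvent_iff]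
  constructor
  · rintro ⟨ρ, σ, hρ, hσ, hS⟩
    have hρd : ∀ k ≤ depth u, rayVtx ρ k = up k u := fun k hk => by
      rw [← up_rayVtx ρ hk, hρ.1]
    have hσd : ∀ k ≤ depth v, rayVtx σ k = up k v := fun k hk => by
      rw [← up_rayVtx σ hk, hσ.1]
    have hρz : rayVtx ρ (depth (parentV e₀)) = parentV e₀ := by
      rw [hparent, hρd d hdu.le, heq, hpar]
    have hσz : rayVtx σ (depth (childV e₀)) = childV e₀ := by
      rw [hchild, hσd (d + 1) hdv, he₀, childV]
    have hρo : OpenFrom (pin P (below u ∪ below v) ω) (parentV e₀) ρ := by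
      refine ⟨hρz, fun k hk => pin_eq_true.2 ?_⟩
      rw [hparent] at hk
      rcases lt_or_ge k (depth u) with hku | hku
      · exact Or.inl (Or.inl ⟨(mem_above_iff hρ.1 _).2 ⟨k, hku, rfl⟩, by simpa using hk⟩)
      · exact Or.inr ⟨Or.inl (rayEdge_mem_below.2 ⟨hku, hρ.1⟩), hρ.2 k hku⟩
    have hσo : OpenFrom (pin P (below u ∪ below v) ω) (childV e₀) σ := by
      refine ⟨hσz, fun k hk => pin_eq_true.2 ?_⟩
      rw [hchild] at hk
      rcases lt_or_ge k (depth v) with hkv | hkv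
      · exact Or.inl (Or.inr ⟨(mem_above_iff hσ.1 _).2 ⟨k, hkv, rfl⟩, by simpa using hk⟩)
      · exact Or.inr ⟨Or.inr (rayEdge_mem_below.2 ⟨hkv, hσ.1⟩), hσ.2 k hkv⟩
    have hρe : rayVtx ρ (d + 1) ≠ childV e₀ := by
      rw [hρd (d + 1) hdu, childV, ← he₀]
      exact hne
    refine ⟨tailPath ρ _ hρz, tailPath σ _ hσz, ?_, hρo.openPath, hσo.openPath, ?_, ?_, ρ, σ,
      (tailPath_follows _ _ _).assoc, (tailPath_follows _ _ _).assoc, hS⟩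
    · intro a b hab
      simp only [tailPath, hparent, hchild] at hab
      have hd := congrArg depth hab
      simp only [depth_rayVtx] at hd
      have := congrArg (up (d + 1)) hab
      rw [up_rayVtx _ (by omega), up_rayVtx _ (by omega)] at this
      apply hρe
      rw [this, ← hchild, hσz]
    · intro e he hl
      obtain ⟨k, hk, rfl⟩ := (mem_edges_of_follows_zero (tailPath_follows ρ _ hρz) e).1 he
      rw [hparent] at hk
      have hc : rayVtx ρ (k + 1) ∈ ({parentV e₀, childV e₀} : Set (V m)) := hl.2
      rcases hc with hc | hc
      · have := congrArg depth hc
        rw [depth_rayVtx, hparent] at this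
        omega
      · have hd := congrArg depth hc
        rw [depth_rayVtx, hchild] at hd
        exact hρe (hd ▸ hc)
    · intro e he
      obtain ⟨k, hk, rfl⟩ := (mem_edges_of_follows_zero (tailPath_follows σ _ hσz) e).1 he
      refine rayEdge_notMem_ELam (D := d + 1) ?_ (hchild ▸ hk) σ
      rintro w (rfl | rfl) <;> omega
  · rintro ⟨πu, πv, -, hou, hov, hlu, hlv, ρ, σ, hρ, hσ, hS⟩
    have he₀L : e₀ ∈ ELam ({parentV e₀, childV e₀} : Set (V m)) := ⟨by simp, by simp⟩
    have hfu : πu.Forward := πu.forward_of_not_back fun e he hback => by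
      have hd := congrArg depth hback
      rw [depth_childV, hparent] at hd
      rcases pin_eq_true.1 (hou e he) with (⟨-, h'⟩ | ⟨-, h'⟩) | ⟨⟨-, h'⟩ | ⟨-, h'⟩, -⟩
      · have : d ≤ e.2.length := h'
        omega
      · have : d + 1 ≤ e.2.length := h'
        omega
      · omega
      · omega
    have hfv : πv.Forward := πv.forward_of_not_back fun e he hback => by
      obtain rfl : e = e₀ := Option.some.inj hback
      exact hlv e he he₀L
    obtain ⟨ρ', hρ'⟩ := hfu.exists_follows
    obtain ⟨σ', hσ'⟩ := hfv.exists_follows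
    obtain rfl := (hρ'.assoc_iff ρ).1 hρ
    obtain rfl := (hσ'.assoc_iff σ).1 hσ
    have hρo := IPath.openFrom hρ' hou
    have hσo := IPath.openFrom hσ' hov
    have hρe : rayVtx ρ (d + 1) ≠ up (d + 1) v := fun hc => by
      rw [he₀] at hc
      have hmem : e₀ ∈ πu.edges :=
        (mem_edges_of_follows_zero hρ' e₀).2 ⟨d, hparent.le, ((rayEdge_eq_iff ρ d e₀).2 hc).symm⟩
      exact hlu e₀ hmem he₀L
    have hσe : rayVtx σ (d + 1) = up (d + 1) v := by
      rw [← hchild, hσo.1, hchild, he₀, childV]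
    have hρu : rayVtx ρ (depth u) = u := (through_or_through hP hρo).resolve_right fun hv =>
      hρe (by rw [← up_rayVtx ρ hdv, hv])
    have hσv : rayVtx σ (depth v) = v := (through_or_through hP hσo).resolve_left fun hu =>
      hne (by rw [← hσe, ← up_rayVtx σ hdu, hu])
    rw [Set.union_comm] at hσo
    exact ⟨ρ, σ, hρo.of_pin hP huv (by omega) hρu, hσo.of_pin hP' hvu (by omega) hσv, hS⟩

/-- For a symmetric reflexive relation `S` on the set of rays of `T'_m`,
the six measurability conditions are equivalent. -/
theorem measurability_tfae (m : ℕ) (hm : 2 ≤ m) (S : Ray m → Ray m → Prop)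
    (hrefl : ∀ ρ, S ρ ρ) (hsymm : ∀ ρ₁ ρ₂, S ρ₁ ρ₂ → S ρ₂ ρ₁) :
    List.TFAE
      [∀ u v : V m, MeasurableSet (AEvent S u v),
       ∀ u v : V m, MeasurableSet (APrimeEvent S u v),
       ∀ u v : V m, ¬ Comparable u v → MeasurableSet (AEvent S u v),
       ∀ u v : V m, MeasurableSet (KEvent S {u, v} u v),
       ∀ Λ : Set (V m), Λ.Finite → ∀ u ∈ Λ, ∀ v ∈ Λ, MeasurableSet (KEvent S Λ u v),
       ∀ e : Edge m, MeasurableSet (KEvent S {parentV e, childV e} (parentV e) (childV e))] := by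
  tfae_have 1 → 2 := fun h u v => by
    rw [APrimeEvent_eq]
    exact (h u v).inter (measurableSet_forall_open _)
  tfae_have 2 → 3 := fun h u v huv =>
    measurableSet_AEvent_of_APrimeEvent S ((not_comparable_iff u v).1 huv).1
      ((not_comparable_iff u v).1 huv).2 (h u v)
  tfae_have 3 → 1 := measurableSet_AEvent_of_incomparable S hrefl hsymm
  tfae_have 3 → 5 := fun h _ hΛ u _ v _ => measurableSet_KEvent S h hΛ u v
  tfae_have 5 → 4 := fun h u v => h {u, v} (Set.toFinite _) u (by simp) v (by simp)
  tfae_have 4 → 6 := fun h e => h _ _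
  tfae_have 6 → 3 := fun h u v huv =>
    measurableSet_AEvent_of_KEvent S h ((not_comparable_iff u v).1 huv).1
      ((not_comparable_iff u v).1 huv).2
  tfae_finish

end RCTree
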